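/- For every integer n ≥ 1, the double sum U_2(n) = 0 in ℚ(q). -/

import Mathlib

open Finset

noncomputable def q : RatFunc ℚ := RatFunc.X

noncomputable def qPoch (a : RatFunc ℚ) (n : ℕ) : RatFunc ℚ :=
  ∏ k ∈ Finset.range n, (1 - a * q ^ k)

noncomputable def qPochZ (a : RatFunc ℚ) (n : ℤ) : RatFunc ℚ :=
  if 0 ≤ n then qPoch a n.toNat else 1 / qPoch (a * q ^ n) (-n).toNat

noncomputable def qbinom (n m : ℤ) : RatFunc ℚ :=
  if 0 ≤ m ∧ m ≤ n then
    qPoch q n.toNat / (qPoch q m.toNat * qPoch q (n - m).toNat)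
  else 0

/-- The multiple sum `U_m(n)`, with the cyclic convention `r_{m+1} = r_1`. -/
noncomputable def Umul (m : ℕ) [NeZero m] (n : ℕ) : RatFunc ℚ :=
  ∑ r ∈ Fintype.piFinset (fun _ : Fin m => Finset.range (2 * n + 2)),
    ∏ k : Fin m,
      ((-1 : RatFunc ℚ) ^ r k * q ^ (r k * (r k - 1) / 2) *
        qPochZ (-q) ((n : ℤ) - r k) * qbinom (2 * (n : ℤ) - r k + 1) (r (k + 1)))

/-- The multiple sum `W_m(n)`, with the cyclic convention `r_{m+1} = r_1`. -/
noncomputable def Wmul (m : ℕ) [NeZero m] (n : ℕ) : RatFunc ℚ :=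
  ∑ r ∈ Fintype.piFinset (fun _ : Fin m => Finset.range (2 * n + 1)),
    ∏ k : Fin m,
      ((-1 : RatFunc ℚ) ^ r k * q ^ (r k * (r k - 1) / 2) *
        qPochZ (-q) ((n : ℤ) - r k) * qbinom (2 * (n : ℤ) - r k) (r (k + 1)))

section ReversalOperator
open Polynomial

variable {K : Type*} [Field K]

/-- The `q`-shifted factorial `(X; t)_k`, as a polynomial. -/
noncomputable def shiftedFactorial (t : K) (k : ℕ) : K[X] :=
  ∏ i ∈ range k, (1 - C (t ^ i) * X)

/-- The substitution `X ↦ c X`. -/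
noncomputable def dilate (c : K) : K[X] →ₐ[K] K[X] := aeval (C c * X)

/-- Division by `X`, discarding the constant term, as a linear map. -/
noncomputable def divXLinear : K[X] →ₗ[K] K[X] where
  toFun := divX
  map_add' _ _ := divX_add
  map_smul' c p := by simp [smul_eq_C_mul, divX_C_mul]

/-- The linear map `X ^ r ↦ (w; t)_{N - r} (X; t)_{N - r}` for `r ≤ N`. -/
noncomputable def reversal (t w : K) (N : ℕ) : K[X] →ₗ[K] K[X] :=
  (basisMonomials K).constr K fun r =>
    if r ≤ N then (shiftedFactorial t (N - r)).eval w • shiftedFactorial t (N - r) else 0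

/-- The operator `p ↦ (1 - X) p(t X)`, which sends `(X; t)_k` to `(X; t)_{k + 1}`. -/
noncomputable def raise (t : K) : K[X] →ₗ[K] K[X] :=
  LinearMap.mulLeft K (1 - X) ∘ₗ (dilate t).toLinearMap

/-- The operator for which `(X; t)_k` is an eigenvector with eigenvalue `t ^ k / t ^ N`. -/
noncomputable def dualDilate (t : K) (N : ℕ) : K[X] →ₗ[K] K[X] :=
  (t ^ N)⁻¹ • ((dilate t).toLinearMap + divXLinear ∘ₗ (LinearMap.id - (dilate t).toLinearMap))

/-- The transform of `dualDilate` under `reversal`. -/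
noncomputable def triDilate (t w : K) (N : ℕ) : K[X] →ₗ[K] K[X] :=
  ((t ^ (N + 1))⁻¹ * w) • (divXLinear ∘ₗ (raise t ∘ₗ raise t - raise t)) +
    ((t ^ N)⁻¹ + w) • raise t + LinearMap.mulLeft K X

/-- The transform of `triDilate` under `reversal`, whose own transform is `dilate t⁻¹`. -/
noncomputable def biDilate (t w : K) (N : ℕ) : K[X] →ₗ[K] K[X] :=
  (t ^ N)⁻¹ • raise t + (1 + w / t) • LinearMap.mulLeft K X -
    (w * t ^ N / t) • (LinearMap.mulLeft K X ∘ₗ (dilate t⁻¹).toLinearMap)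

@[simp] lemma divXLinear_X_mul (p : K[X]) : divXLinear (X * p) = p := by
  ext n; simp [divXLinear, coeff_divX]

@[simp] lemma dilate_X_pow (c : K) (r : ℕ) : dilate c (X ^ r) = c ^ r • X ^ r := by
  simp [dilate, mul_pow, smul_eq_C_mul]

lemma coeff_dilate (c : K) (p : K[X]) (j : ℕ) : (dilate c p).coeff j = c ^ j * p.coeff j := by
  induction p using Polynomial.induction_on' with
  | add p q hp hq => simp [hp, hq, mul_add]
  | monomial r a =>
    rw [← C_mul_X_pow_eq_monomial, ← smul_eq_C_mul, map_smul, dilate_X_pow]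
    simp only [coeff_smul, coeff_X_pow, smul_eq_mul]
    split_ifs with h
    · subst h; ring
    · simp

@[simp] lemma shiftedFactorial_zero (t : K) : shiftedFactorial t 0 = 1 := by
  simp [shiftedFactorial]

lemma shiftedFactorial_succ (t : K) (k : ℕ) :
    shiftedFactorial t (k + 1) = shiftedFactorial t k * (1 - C (t ^ k) * X) := by
  simp [shiftedFactorial, prod_range_succ]

lemma eval_shiftedFactorial_succ (t w : K) (k : ℕ) :
    (shiftedFactorial t (k + 1)).eval w = (shiftedFactorial t k).eval w * (1 - t ^ k * w) := by
  simp [shiftedFactorial_succ]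

lemma natDegree_shiftedFactorial_le (t : K) (k : ℕ) : (shiftedFactorial t k).natDegree ≤ k := by
  induction k with
  | zero => simp
  | succ k ih =>
    rw [shiftedFactorial_succ]
    refine natDegree_mul_le.trans (add_le_add ih ?_)
    compute_degree

lemma X_mul_shiftedFactorial {t : K} (ht : t ≠ 0) (k : ℕ) :
    X * shiftedFactorial t k =
      (t ^ k)⁻¹ • (shiftedFactorial t k - shiftedFactorial t (k + 1)) := by
  have h : shiftedFactorial t k - shiftedFactorial t (k + 1) =
      t ^ k • (X * shiftedFactorial t k) := by
    rw [shiftedFactorial_succ, smul_eq_C_mul]; ring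
  rw [h, smul_smul, inv_mul_cancel₀ (pow_ne_zero _ ht), one_smul]

@[simp] lemma raise_shiftedFactorial (t : K) (k : ℕ) :
    raise t (shiftedFactorial t k) = shiftedFactorial t (k + 1) := by
  simp only [raise, dilate, shiftedFactorial, prod_range_succ', map_prod, pow_succ,
    LinearMap.comp_apply, AlgHom.toLinearMap_apply, LinearMap.mulLeft_apply, map_sub, map_mul,
    map_one, aeval_X, aeval_C, algebraMap_eq, pow_zero, one_mul]
  rw [mul_comm]
  congr 1
  exact prod_congr rfl fun i _ => by ring

lemma dilate_inv_shiftedFactorial {t : K} (ht : t ≠ 0) (k : ℕ) :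
    dilate t⁻¹ (shiftedFactorial t k) = (t ^ k)⁻¹ • shiftedFactorial t k +
      (1 - (t ^ k)⁻¹) • shiftedFactorial t (k - 1) := by
  cases k with
  | zero => simp
  | succ k =>
    have h : dilate t⁻¹ (shiftedFactorial t (k + 1)) =
        (1 - C t⁻¹ * X) * shiftedFactorial t k := by
      simp only [dilate, shiftedFactorial, prod_range_succ', map_prod, map_mul, map_sub, map_one,
        aeval_X, aeval_C, algebraMap_eq, pow_zero, one_mul]
      rw [mul_comm]
      congr 1
      refine prod_congr rfl fun i _ => ?_
      rw [← mul_assoc, ← C_mul, pow_succ, mul_assoc, mul_inv_cancel₀ ht, mul_one]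
    rw [h, sub_mul, one_mul, mul_assoc, X_mul_shiftedFactorial ht, ← smul_eq_C_mul,
      Nat.add_sub_cancel]
    match_scalars <;> field_simp <;> ring

lemma dualDilate_shiftedFactorial {t : K} (N k : ℕ) :
    dualDilate t N (shiftedFactorial t k) = (t ^ k / t ^ N) • shiftedFactorial t k := by
  cases k with
  | zero => simp [dualDilate]
  | succ k =>
    have h := raise_shiftedFactorial t k
    have h1 : dilate t (shiftedFactorial t (k + 1)) =
        (1 - C (t ^ (k + 1)) * X) * dilate t (shiftedFactorial t k) := by
      rw [shiftedFactorial_succ, map_mul, mul_comm]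
      simp only [dilate, map_sub, map_one, map_mul, aeval_C, aeval_X, algebraMap_eq, pow_succ]
      ring
    have h2 : shiftedFactorial t (k + 1) - dilate t (shiftedFactorial t (k + 1)) =
        X * ((t ^ (k + 1) - 1) • dilate t (shiftedFactorial t k)) := by
      rw [h1, ← h]
      simp [raise, smul_eq_C_mul]
      ring
    simp only [dualDilate, LinearMap.smul_apply, LinearMap.add_apply, LinearMap.comp_apply,
      LinearMap.sub_apply, LinearMap.id_apply, AlgHom.toLinearMap_apply]
    rw [h2, divXLinear_X_mul, h1, ← h, div_eq_inv_mul, mul_smul]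
    congr 1
    simp [raise, smul_eq_C_mul]
    ring

lemma triDilate_shiftedFactorial {t : K} (ht : t ≠ 0) (w : K) (N k : ℕ) :
    triDilate t w N (shiftedFactorial t k) = (t ^ k)⁻¹ • shiftedFactorial t k +
      ((t ^ N)⁻¹ * (1 - t ^ N / t ^ k) * (1 - t ^ k * w)) • shiftedFactorial t (k + 1) := by
  have h : shiftedFactorial t (k + 2) - shiftedFactorial t (k + 1) =
      X * (-t ^ (k + 1) • shiftedFactorial t (k + 1)) := by
    rw [shiftedFactorial_succ t (k + 1), smul_eq_C_mul, C_neg]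
    ring
  simp only [triDilate, LinearMap.smul_apply, LinearMap.add_apply, LinearMap.comp_apply,
    LinearMap.sub_apply, LinearMap.mulLeft_apply, raise_shiftedFactorial]
  rw [h, divXLinear_X_mul, X_mul_shiftedFactorial ht]
  match_scalars <;> field_simp
  ring

lemma biDilate_shiftedFactorial {t : K} (ht : t ≠ 0) (w : K) (N k : ℕ) :
    biDilate t w N (shiftedFactorial t k) =
      ((t ^ N)⁻¹ * (1 - t ^ N / t ^ k) * (1 - w * t ^ N / t ^ (k + 1))) •
          shiftedFactorial t (k + 1) +
        ((1 + w / t) / t ^ k - w * t ^ N / t / t ^ (2 * k) + w * t ^ N / t ^ k * (1 - (t ^ k)⁻¹)) •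
          shiftedFactorial t k -
        (w * t ^ N / t ^ k * (1 - (t ^ k)⁻¹)) • shiftedFactorial t (k - 1) := by
  simp only [biDilate, LinearMap.smul_apply, LinearMap.add_apply, LinearMap.comp_apply,
    LinearMap.sub_apply, LinearMap.mulLeft_apply, raise_shiftedFactorial,
    AlgHom.toLinearMap_apply, dilate_inv_shiftedFactorial ht, mul_add, mul_smul_comm,
    X_mul_shiftedFactorial ht]
  cases k with
  | zero =>
    simp only [pow_zero, inv_one, sub_self, zero_smul, mul_zero]
    match_scalars <;> field_simp <;> ring
  | succ k =>
    simp only [Nat.add_sub_cancel]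
    match_scalars <;> field_simp <;> ring


lemma reversal_X_pow (t w : K) (m r : ℕ) :
    reversal t w (m + r) (X ^ r) =
      (shiftedFactorial t m).eval w • shiftedFactorial t m := by
  have h : (X ^ r : K[X]) = basisMonomials K r := by simp [X_pow_eq_monomial]
  rw [h, reversal, Module.Basis.constr_basis]
  simp

lemma smul_reversal_X_pow_pred (t w : K) (m r : ℕ) :
    (1 - t ^ r) • reversal t w (m + r) (X ^ (r - 1)) =
      ((1 - t ^ r) * (shiftedFactorial t (m + 1)).eval w) • shiftedFactorial t (m + 1) := by
  cases r with
  | zero => simp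
  | succ r =>
    rw [show m + (r + 1) = m + 1 + r by ring, Nat.add_sub_cancel, reversal_X_pow, smul_smul]

lemma smul_reversal_X_pow_succ (t w : K) (m r : ℕ) :
    (1 - (t ^ m)⁻¹) • reversal t w (m + r) (X ^ (r + 1)) =
      ((1 - (t ^ m)⁻¹) * (shiftedFactorial t (m - 1)).eval w) • shiftedFactorial t (m - 1) := by
  cases m with
  | zero => simp
  | succ m =>
    rw [show m + 1 + r = m + (r + 1) by ring, Nat.add_sub_cancel, reversal_X_pow, smul_smul]

lemma raise_X_pow (t : K) (r : ℕ) : raise t (X ^ r) = t ^ r • (X ^ r - X ^ (r + 1)) := by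
  simp only [raise, LinearMap.comp_apply, AlgHom.toLinearMap_apply, dilate_X_pow,
    LinearMap.mulLeft_apply, mul_smul_comm]
  congr 1
  ring

lemma dualDilate_X_pow (t : K) (N r : ℕ) :
    dualDilate t N (X ^ r) = (t ^ N)⁻¹ • (t ^ r • X ^ r + (1 - t ^ r) • X ^ (r - 1)) := by
  have h : X ^ r - t ^ r • X ^ r = X * ((1 - t ^ r) • X ^ (r - 1) : K[X]) := by
    cases r with
    | zero => simp
    | succ r => rw [Nat.add_sub_cancel, mul_smul_comm, ← pow_succ']; module
  simp only [dualDilate, LinearMap.smul_apply, LinearMap.add_apply, LinearMap.comp_apply,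
    LinearMap.sub_apply, LinearMap.id_apply, AlgHom.toLinearMap_apply, dilate_X_pow, h,
    divXLinear_X_mul]

lemma triDilate_X_pow (t w : K) (N r : ℕ) :
    triDilate t w N (X ^ r) =
      ((t ^ (N + 1))⁻¹ * w * t ^ r) • ((t ^ r - 1) • X ^ (r - 1) +
        (1 - (1 + t) * t ^ r) • X ^ r + (t * t ^ r) • X ^ (r + 1)) +
      (((t ^ N)⁻¹ + w) * t ^ r) • (X ^ r - X ^ (r + 1)) + X ^ (r + 1) := by
  have h : raise t (raise t (X ^ r)) - raise t (X ^ r) = X * (t ^ r • ((t ^ r - 1) • X ^ (r - 1) +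
      (1 - (1 + t) * t ^ r) • X ^ r + (t * t ^ r) • X ^ (r + 1)) : K[X]) := by
    cases r with
    | zero =>
      simp only [raise_X_pow, map_smul, map_sub]
      simp only [smul_eq_C_mul, pow_zero, C_1, C_mul, map_sub, C_add, pow_succ]
      ring
    | succ r =>
      simp only [raise_X_pow, map_smul, map_sub]
      simp only [smul_eq_C_mul, C_1, C_mul, map_sub, C_add, pow_succ, Nat.add_sub_cancel]
      ring
  simp only [triDilate, LinearMap.smul_apply, LinearMap.add_apply, LinearMap.comp_apply,
    LinearMap.sub_apply]
  rw [h, divXLinear_X_mul, LinearMap.mulLeft_apply, ← pow_succ' (X : K[X]) r, raise_X_pow]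
  module

lemma biDilate_X_pow {t : K} (ht : t ≠ 0) (w : K) (N r : ℕ) :
    biDilate t w N (X ^ r) = (t ^ r / t ^ N) • X ^ r +
      ((1 - t ^ r / t ^ N) * (1 - w * t ^ N / t ^ (r + 1))) • X ^ (r + 1) := by
  simp only [biDilate, LinearMap.smul_apply, LinearMap.add_apply, LinearMap.comp_apply,
    LinearMap.sub_apply, LinearMap.mulLeft_apply, raise_X_pow, AlgHom.toLinearMap_apply,
    dilate_X_pow, mul_smul_comm, ← pow_succ', inv_pow]
  match_scalars <;> field_simp
  ring

lemma reversal_dilate_X_pow {t : K} (ht : t ≠ 0) (w : K) (m r : ℕ) :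
    reversal t w (m + r) (dilate t⁻¹ (X ^ r)) =
      dualDilate t (m + r) (reversal t w (m + r) (X ^ r)) := by
  rw [dilate_X_pow, map_smul, reversal_X_pow, map_smul, dualDilate_shiftedFactorial, inv_pow]
  match_scalars
  field_simp
  ring

lemma reversal_dualDilate_X_pow {t : K} (ht : t ≠ 0) (w : K) (m r : ℕ) :
    reversal t w (m + r) (dualDilate t (m + r) (X ^ r)) =
      triDilate t w (m + r) (reversal t w (m + r) (X ^ r)) := by
  rw [dualDilate_X_pow, map_smul, map_add, map_smul, map_smul, smul_reversal_X_pow_pred,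
    reversal_X_pow, map_smul, triDilate_shiftedFactorial ht, eval_shiftedFactorial_succ]
  match_scalars <;> field_simp <;> ring

lemma reversal_biDilate_X_pow {t : K} (ht : t ≠ 0) (w : K) (m r : ℕ) :
    reversal t w (m + r) (biDilate t w (m + r) (X ^ r)) =
      dilate t⁻¹ (reversal t w (m + r) (X ^ r)) := by
  have h1 : t ^ r / t ^ (m + r) = (t ^ m)⁻¹ := by field_simp; ring
  rw [biDilate_X_pow ht, h1, map_add, map_smul, mul_comm, mul_smul, map_smul, map_smul,
    smul_reversal_X_pow_succ, reversal_X_pow, map_smul, dilate_inv_shiftedFactorial ht]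
  cases m with
  | zero => simp
  | succ m =>
    rw [Nat.add_sub_cancel, eval_shiftedFactorial_succ]
    match_scalars <;> field_simp
    ring

lemma reversal_triDilate_X_pow {t w : K} (ht : t ≠ 0) (m r : ℕ) (hw : w ^ 2 * t ^ (m + r) = t) :
    reversal t w (m + r) (triDilate t w (m + r) (X ^ r)) =
      biDilate t w (m + r) (reversal t w (m + r) (X ^ r)) := by
  have hw0 : w ≠ 0 := by
    rintro rfl
    simp [ht.symm] at hw
  have h1 : triDilate t w (m + r) (X ^ r) =
      (-(t ^ (m + r + 1))⁻¹ * w * t ^ r) • ((1 - t ^ r) • X ^ (r - 1)) +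
      ((t ^ (m + r + 1))⁻¹ * w * t ^ r * (1 - (1 + t) * t ^ r) +
        ((t ^ (m + r))⁻¹ + w) * t ^ r) • X ^ r +
      (w * t ^ (m + r) * (w / t - (t ^ m)⁻¹)) • ((1 - (t ^ m)⁻¹) • X ^ (r + 1)) := by
    rw [triDilate_X_pow]
    match_scalars
    · field_simp
      ring
    · field_simp
    · simp only [pow_add, pow_one] at hw ⊢
      have ha := pow_ne_zero m ht
      have hb := pow_ne_zero r ht
      generalize t ^ m = a at *
      generalize t ^ r = b at *
      subst_vars
      field_simp
      ring
  rw [h1, map_add, map_add, map_smul, map_smul, map_smul, map_smul, map_smul,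
    smul_reversal_X_pow_pred, smul_reversal_X_pow_succ, reversal_X_pow, map_smul,
    biDilate_shiftedFactorial ht, eval_shiftedFactorial_succ]
  cases m with
  | zero =>
    have hb : t ^ r = t / w ^ 2 := by
      rw [zero_add] at hw
      field_simp
      linear_combination hw
    simp only [pow_add, pow_one, pow_zero, mul_zero, hb]
    match_scalars <;> field_simp <;> ring
  | succ m =>
    have hb : t ^ r = 1 / (w ^ 2 * t ^ m) := by
      field_simp
      apply mul_right_cancel₀ ht
      linear_combination hw
    rw [Nat.add_sub_cancel, eval_shiftedFactorial_succ]
    simp only [pow_add, pow_one, hb]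
    match_scalars <;> field_simp <;> ring

lemma linearMap_eq_of_natDegree_le {N : ℕ} {f g : K[X] →ₗ[K] K[X]}
    (h : ∀ m r, m + r = N → f (X ^ r) = g (X ^ r)) {p : K[X]} (hp : p.natDegree ≤ N) :
    f p = g p := by
  rw [p.as_sum_range_C_mul_X_pow' (Nat.lt_succ_of_le hp)]
  simp only [map_sum, ← smul_eq_C_mul, map_smul]
  refine sum_congr rfl fun r hr => ?_
  rw [h (N - r) r (by have := mem_range.1 hr; omega)]

lemma natDegree_reversal_le (t w : K) (N : ℕ) (p : K[X]) : (reversal t w N p).natDegree ≤ N := by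
  rw [reversal, Module.Basis.constr_apply]
  refine natDegree_sum_le_of_forall_le _ _ fun r _ => (natDegree_smul_le _ _).trans ?_
  split_ifs
  · exact (natDegree_smul_le _ _).trans <|
      (natDegree_shiftedFactorial_le t _).trans (Nat.sub_le N r)
  · simp

/-- The fourth power of `reversal` commutes with dilation. -/
lemma reversal_pow_four_dilate {t w : K} {N : ℕ} (ht : t ≠ 0) (hw : w ^ 2 * t ^ N = t)
    {p : K[X]} (hp : p.natDegree ≤ N) :
    (reversal t w N ^ 4) (dilate t⁻¹ p) = dilate t⁻¹ ((reversal t w N ^ 4) p) := by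
  have hdeg : ∀ p, (reversal t w N p).natDegree ≤ N := natDegree_reversal_le t w N
  have h1 {p : K[X]} (hp : p.natDegree ≤ N) :
      reversal t w N (dilate t⁻¹ p) = dualDilate t N (reversal t w N p) :=
    linearMap_eq_of_natDegree_le (f := reversal t w N ∘ₗ (dilate t⁻¹).toLinearMap)
      (g := dualDilate t N ∘ₗ reversal t w N)
      (by
        rintro m r rfl
        simpa only [LinearMap.comp_apply, AlgHom.toLinearMap_apply] using
          reversal_dilate_X_pow ht w m r) hp
  have h2 {p : K[X]} (hp : p.natDegree ≤ N) :
      reversal t w N (dualDilate t N p) = triDilate t w N (reversal t w N p) :=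
    linearMap_eq_of_natDegree_le (f := reversal t w N ∘ₗ dualDilate t N)
      (g := triDilate t w N ∘ₗ reversal t w N)
      (by
        rintro m r rfl
        simpa only [LinearMap.comp_apply, AlgHom.toLinearMap_apply] using
          reversal_dualDilate_X_pow ht w m r) hp
  have h3 {p : K[X]} (hp : p.natDegree ≤ N) :
      reversal t w N (triDilate t w N p) = biDilate t w N (reversal t w N p) :=
    linearMap_eq_of_natDegree_le (f := reversal t w N ∘ₗ triDilate t w N)
      (g := biDilate t w N ∘ₗ reversal t w N)
      (by
        rintro m r rfl
        simpa only [LinearMap.comp_apply, AlgHom.toLinearMap_apply] using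
          reversal_triDilate_X_pow ht m r hw) hp
  have h4 {p : K[X]} (hp : p.natDegree ≤ N) :
      reversal t w N (biDilate t w N p) = dilate t⁻¹ (reversal t w N p) :=
    linearMap_eq_of_natDegree_le (f := reversal t w N ∘ₗ biDilate t w N)
      (g := (dilate t⁻¹).toLinearMap ∘ₗ reversal t w N)
      (by
        rintro m r rfl
        simpa only [LinearMap.comp_apply, AlgHom.toLinearMap_apply] using
          reversal_biDilate_X_pow ht w m r) hp
  simp only [pow_succ, pow_zero, Module.End.mul_apply, Module.End.one_apply]
  rw [h1 hp, h2 (hdeg _), h3 (hdeg _), h4 (hdeg _)]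

lemma coeff_shiftedFactorial_succ (t : K) (k j : ℕ) :
    (1 - t ^ (j + 1)) * (shiftedFactorial t k).coeff (j + 1) =
      (t ^ k - t ^ j) * (shiftedFactorial t k).coeff j := by
  have h := congrArg (fun p => coeff p j) (dualDilate_shiftedFactorial (t := t) 0 k)
  simp only [dualDilate, divXLinear, pow_zero, inv_one, one_smul, div_one, LinearMap.add_apply,
    LinearMap.comp_apply, LinearMap.sub_apply, LinearMap.id_apply, AlgHom.toLinearMap_apply,
    LinearMap.coe_mk, AddHom.coe_mk, coeff_add, coeff_divX, coeff_sub, coeff_dilate, coeff_smul,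
    smul_eq_mul] at h
  linear_combination h

lemma coeff_zero_shiftedFactorial (t : K) (k : ℕ) : (shiftedFactorial t k).coeff 0 = 1 := by
  induction k with
  | zero => simp
  | succ k ih => simp [shiftedFactorial_succ, mul_coeff_zero, ih]

lemma coeff_shiftedFactorial_ne_zero {t : K} (ht : t ≠ 0) (ht1 : ∀ i, t ^ (i + 1) ≠ 1) {k j : ℕ}
    (hj : j ≤ k) : (shiftedFactorial t k).coeff j ≠ 0 := by
  induction j with
  | zero => simp [coeff_zero_shiftedFactorial]
  | succ j ih =>
    intro h
    have h1 := coeff_shiftedFactorial_succ t k j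
    rw [h, mul_zero, eq_comm, mul_eq_zero, or_iff_left (ih (by omega)), sub_eq_zero] at h1
    obtain ⟨i, rfl⟩ : ∃ i, k = j + (i + 1) := ⟨k - j - 1, by omega⟩
    rw [pow_add, mul_eq_left₀ (pow_ne_zero _ ht)] at h1
    exact ht1 i h1

lemma coeff_self_shiftedFactorial (t : K) (k : ℕ) :
    (shiftedFactorial t k).coeff k = (-1) ^ k * t ^ (k * (k - 1) / 2) := by
  induction k with
  | zero => simp
  | succ k ih =>
    have h : (shiftedFactorial t k).coeff (k + 1) = 0 :=
      coeff_eq_zero_of_natDegree_lt (Nat.lt_succ_of_le (natDegree_shiftedFactorial_le t k))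
    rw [shiftedFactorial_succ, mul_sub, coeff_sub, mul_one, h, mul_left_comm, coeff_C_mul,
      coeff_mul_X, ih, ← Finset.sum_range_id, ← Finset.sum_range_id, Finset.sum_range_succ]
    ring

lemma eval_one_shiftedFactorial_succ (t : K) (k : ℕ) :
    (shiftedFactorial t (k + 1)).eval 1 = 0 := by
  induction k with
  | zero => simp [shiftedFactorial]
  | succ k ih => simp [shiftedFactorial_succ t (k + 1), ih]

lemma eval_one_reversal (t w : K) {N : ℕ} {p : K[X]} (hp : p.natDegree ≤ N) :
    (reversal t w N p).eval 1 = p.coeff N := by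
  rw [p.as_sum_range_C_mul_X_pow' (Nat.lt_succ_of_le hp)]
  simp only [map_sum, ← smul_eq_C_mul, map_smul, eval_finsetSum, eval_smul, finsetSum_coeff,
    coeff_smul, coeff_X_pow]
  refine sum_congr rfl fun r hr => ?_
  obtain ⟨m, rfl⟩ := Nat.exists_eq_add_of_le' (Nat.lt_succ_iff.1 (mem_range.1 hr))
  rw [reversal_X_pow]
  cases m with
  | zero => simp
  | succ m => simp [eval_one_shiftedFactorial_succ]

lemma coeff_self_reversal (t w : K) {N : ℕ} {p : K[X]} (hp : p.natDegree ≤ N) :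
    (reversal t w N p).coeff N =
      p.coeff 0 * ((shiftedFactorial t N).eval w * ((-1) ^ N * t ^ (N * (N - 1) / 2))) := by
  conv_lhs => rw [p.as_sum_range_C_mul_X_pow' (Nat.lt_succ_of_le hp)]
  simp only [map_sum, ← smul_eq_C_mul, map_smul, finsetSum_coeff, coeff_smul]
  rw [sum_eq_single_of_mem 0 (by simp)]
  · have := reversal_X_pow t w N 0
    rw [add_zero] at this
    rw [this, coeff_smul, coeff_self_shiftedFactorial, smul_eq_mul, smul_eq_mul]
  · intro r hr hr0
    obtain ⟨m, rfl⟩ := Nat.exists_eq_add_of_le' (Nat.lt_succ_iff.1 (mem_range.1 hr))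
    have h : (shiftedFactorial t m).coeff (m + r) = 0 := coeff_eq_zero_of_natDegree_lt <|
      (natDegree_shiftedFactorial_le t m).trans_lt (by omega)
    rw [reversal_X_pow, coeff_smul, h, smul_zero, smul_zero]

lemma pow_right_injective_of_ne_one {t : K} (ht : t ≠ 0) (ht1 : ∀ i, t ^ (i + 1) ≠ 1) :
    Function.Injective (t ^ · : ℕ → K) := by
  intro i j hij
  by_contra hne
  wlog hlt : i < j generalizing i j
  · exact this hij.symm (Ne.symm hne) (by omega)
  obtain ⟨k, rfl⟩ : ∃ k, j = i + (k + 1) := ⟨j - i - 1, by omega⟩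
  simp only [pow_add t i, left_eq_mul₀ (pow_ne_zero i ht)] at hij
  exact ht1 k hij

/-- A linear map commuting with a dilation of infinite order is diagonal on monomials. -/
lemma exists_coeff_eq_of_commute_dilate {t : K} (ht : t ≠ 0) (ht1 : ∀ i, t ^ (i + 1) ≠ 1)
    {N : ℕ} (F : K[X] →ₗ[K] K[X])
    (hF : ∀ p : K[X], p.natDegree ≤ N → F (dilate t⁻¹ p) = dilate t⁻¹ (F p)) :
    ∃ c : ℕ → K, ∀ p : K[X], p.natDegree ≤ N → ∀ j ≤ N, (F p).coeff j = c j * p.coeff j := by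
  have hdiag : ∀ r ≤ N, F (X ^ r) = (F (X ^ r)).coeff r • X ^ r := by
    intro r hr
    have h := hF _ ((natDegree_X_pow_le r).trans hr)
    rw [dilate_X_pow, map_smul] at h
    ext j
    have hj := congrArg (fun p => coeff p j) h
    simp only [coeff_smul, coeff_dilate, smul_eq_mul, inv_pow] at hj
    rw [coeff_smul, coeff_X_pow, smul_eq_mul]
    split_ifs with hjr
    · rw [hjr, mul_one]
    · by_contra hc
      rw [mul_zero] at hc
      exact hjr (pow_right_injective_of_ne_one ht ht1
        (inv_injective (mul_right_cancel₀ hc hj))).symm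
  refine ⟨fun r => (F (X ^ r)).coeff r, fun p hp j hj => ?_⟩
  conv_lhs => rw [p.as_sum_range_C_mul_X_pow' (Nat.lt_succ_of_le hp)]
  simp only [map_sum, ← smul_eq_C_mul, map_smul, finsetSum_coeff, coeff_smul]
  rw [sum_eq_single_of_mem j (by simpa using Nat.lt_succ_of_le hj)]
  · simp [mul_comm]
  · intro i hi hij
    rw [hdiag i (Nat.lt_succ_iff.1 (mem_range.1 hi))]
    simp [coeff_X_pow, hij.symm]

lemma reversal_X_pow_zero (t w : K) (N : ℕ) :
    reversal t w N (X ^ 0) = (shiftedFactorial t N).eval w • shiftedFactorial t N := by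
  have := reversal_X_pow t w N 0
  rwa [add_zero] at this

lemma reversal_X_pow_self (t w : K) (N : ℕ) : reversal t w N (X ^ N) = X ^ 0 := by
  have := reversal_X_pow t w 0 N
  rw [zero_add] at this
  simp [this]

/-- The fourth power of `reversal` is a scalar on polynomials of degree at most `N`. -/
lemma reversal_pow_four {t w : K} {N : ℕ} (ht : t ≠ 0) (ht1 : ∀ i, t ^ (i + 1) ≠ 1)
    (hw : w ^ 2 * t ^ N = t) (hw1 : (shiftedFactorial t N).eval w ≠ 0)
    {p : K[X]} (hp : p.natDegree ≤ N) :
    (reversal t w N ^ 4) p =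
      ((-1) ^ N * t ^ (N * (N - 1) / 2) * (shiftedFactorial t N).eval w ^ 2) • p := by
  have hdeg := natDegree_reversal_le t w N
  have h0 := reversal_X_pow_zero t w N
  have hTN := reversal_X_pow_self t w N
  have he := fun p => eval_one_reversal t w (N := N) (p := p)
  have hl := fun p => coeff_self_reversal t w (N := N) (p := p)
  obtain ⟨c, hc⟩ := exists_coeff_eq_of_commute_dilate ht ht1 (reversal t w N ^ 4)
    fun p hp => reversal_pow_four_dilate ht hw hp
  generalize reversal t w N = T at *
  have hdeg4 (p : K[X]) : ((T ^ 4) p).natDegree ≤ N := by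
    rw [pow_succ', Module.End.mul_apply]
    exact hdeg _
  have hX (r : ℕ) (hr : r ≤ N) : (T ^ 4) (X ^ r) = c r • X ^ r := by
    ext j
    rw [coeff_smul, smul_eq_mul]
    by_cases hj : j ≤ N
    · rw [hc _ ((natDegree_X_pow_le r).trans hr) j hj, coeff_X_pow]
      split_ifs with hjr
      · rw [hjr]
      · simp
    · rw [coeff_eq_zero_of_natDegree_lt (by have := hdeg4 (X ^ r); omega), coeff_X_pow,
        if_neg (by omega), mul_zero]
  have hconst : ∀ j ≤ N, c j = c 0 := by
    intro j hj
    have h1 : (T ^ 4) (T (X ^ 0)) = c 0 • T (X ^ 0) := by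
      rw [← Module.End.mul_apply, ← pow_succ, pow_succ', Module.End.mul_apply,
        hX 0 (Nat.zero_le N), map_smul]
    have h2 := hc (T (X ^ 0)) (hdeg _) j hj
    rw [h1, coeff_smul, smul_eq_mul] at h2
    refine (mul_right_cancel₀ ?_ h2).symm
    rw [h0, coeff_smul, smul_eq_mul]
    exact mul_ne_zero hw1 (coeff_shiftedFactorial_ne_zero ht ht1 hj)
  have hval : c 0 = (-1) ^ N * t ^ (N * (N - 1) / 2) * (shiftedFactorial t N).eval w ^ 2 := by
    have hN : T (T (T (T (X ^ N)))) = c N • X ^ N := hX N le_rfl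
    rw [hTN, h0] at hN
    have hv := congrArg (eval 1) hN
    rw [he _ (hdeg _), hl _ ((natDegree_smul_le _ _).trans (natDegree_shiftedFactorial_le t N)),
      coeff_smul, coeff_zero_shiftedFactorial, hconst N le_rfl] at hv
    simp only [eval_smul, eval_pow, eval_X, one_pow, smul_eq_mul, mul_one] at hv
    rw [← hv]
    ring
  ext j
  rw [coeff_smul, smul_eq_mul, ← hval]
  by_cases hj : j ≤ N
  · rw [hc p hp j hj, hconst j hj]
  · rw [coeff_eq_zero_of_natDegree_lt (by have := hdeg4 p; omega),
      coeff_eq_zero_of_natDegree_lt (by omega), mul_zero]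

/-- The matrix of `reversal` in the monomial basis of the polynomials of degree at most `N`. -/
noncomputable def reversalMatrix (t w : K) (N : ℕ) : Matrix (Fin (N + 1)) (Fin (N + 1)) K :=
  Matrix.of fun i j => (reversal t w N (X ^ (j : ℕ))).coeff i

lemma reversalMatrix_mulVec_coeff (t w : K) {N : ℕ} {p : K[X]} (hp : p.natDegree ≤ N) :
    (reversalMatrix t w N).mulVec (fun i : Fin (N + 1) => p.coeff i) =
      fun i : Fin (N + 1) => (reversal t w N p).coeff i := by
  ext i
  conv_rhs => rw [p.as_sum_range_C_mul_X_pow' (Nat.lt_succ_of_le hp)]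
  simp only [map_sum, ← smul_eq_C_mul, map_smul, finsetSum_coeff, coeff_smul, smul_eq_mul,
    Matrix.mulVec, dotProduct, reversalMatrix, Matrix.of_apply, Nat.succ_eq_add_one]
  rw [← Fin.sum_univ_eq_sum_range (fun j => p.coeff j * (reversal t w N (X ^ j)).coeff i)]
  exact sum_congr rfl fun j _ => mul_comm _ _

lemma reversalMatrix_mul_self_mul_self {t w : K} {N : ℕ} (ht : t ≠ 0)
    (ht1 : ∀ i, t ^ (i + 1) ≠ 1) (hw : w ^ 2 * t ^ N = t)
    (hw1 : (shiftedFactorial t N).eval w ≠ 0) :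
    (reversalMatrix t w N * reversalMatrix t w N) * (reversalMatrix t w N * reversalMatrix t w N) =
      ((-1) ^ N * t ^ (N * (N - 1) / 2) * (shiftedFactorial t N).eval w ^ 2) • 1 := by
  refine Matrix.ext_of_mulVec_single fun r => ?_
  have hdeg := natDegree_reversal_le t w N
  have hr : ((X : K[X]) ^ (r : ℕ)).natDegree ≤ N :=
    (natDegree_X_pow_le _).trans (Nat.lt_succ_iff.1 r.2)
  have hsingle : Pi.single r (1 : K) = fun i : Fin (N + 1) => (X ^ (r : ℕ) : K[X]).coeff i := by
    ext i
    simp [coeff_X_pow, Pi.single_apply, Fin.ext_iff]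
  rw [Matrix.smul_mulVec, Matrix.one_mulVec, hsingle, ← Matrix.mulVec_mulVec,
    ← Matrix.mulVec_mulVec, ← Matrix.mulVec_mulVec, reversalMatrix_mulVec_coeff t w hr,
    reversalMatrix_mulVec_coeff t w (hdeg _), reversalMatrix_mulVec_coeff t w (hdeg _),
    reversalMatrix_mulVec_coeff t w (hdeg _)]
  have h := reversal_pow_four ht ht1 hw hw1 hr
  rw [pow_succ _ 3, pow_succ _ 2, pow_succ (reversal t w N) 1, pow_one] at h
  simp only [Module.End.mul_apply] at h
  ext i
  have hi := congrArg (fun p => coeff p (i : ℕ)) h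
  simpa only [coeff_smul, Pi.smul_apply] using hi

end ReversalOperator

/-- The trace of a square root of a scalar matrix is an integer multiple of a square root of
that scalar. -/
lemma Matrix.exists_trace_sq_eq_of_mul_self_eq {K ι : Type*} [Field K] [Fintype ι]
    [DecidableEq ι] {B : Matrix ι ι K} {c : K} (hB : B * B = c • 1) :
    ∃ m : ℤ, B.trace ^ 2 = c * m ^ 2 := by
  let L := AlgebraicClosure K
  obtain ⟨e, he⟩ := IsAlgClosed.exists_pow_nat_eq (algebraMap K L c) two_pos
  set B' : Matrix ι ι L := B.map (algebraMap K L) with hB'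
  have hsq : B' * B' = algebraMap K L c • 1 := by
    rw [hB', ← Matrix.map_mul, hB]
    ext i j
    simp [Matrix.one_apply, apply_ite (algebraMap K L)]
  have hroot : ∀ μ ∈ B'.charpoly.roots, μ = e ∨ μ = -e := by
    intro μ hμ
    have hμ' : μ ∈ spectrum L B' := by
      rw [Matrix.mem_spectrum_iff_isRoot_charpoly]
      exact Polynomial.isRoot_of_mem_roots hμ
    have : Nontrivial (Matrix ι ι L) := by
      by_contra h
      rw [not_nontrivial_iff_subsingleton] at h
      simp [spectrum.of_subsingleton] at hμ'
    have h := spectrum.pow_mem_pow B' 2 hμ'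
    rw [sq B', hsq, ← Algebra.algebraMap_eq_smul_one, spectrum.scalar_eq,
      Set.mem_singleton_iff, ← he] at h
    exact sq_eq_sq_iff_eq_or_eq_neg.1 h
  have hsum : ∀ s : Multiset L, (∀ μ ∈ s, μ = e ∨ μ = -e) → ∃ m : ℤ, s.sum = m * e := by
    intro s
    induction s using Multiset.induction_on with
    | empty => exact fun _ => ⟨0, by simp⟩
    | cons a s ih =>
      intro h
      obtain ⟨m, hm⟩ := ih fun μ hμ => h μ (Multiset.mem_cons_of_mem hμ)
      rcases h a (Multiset.mem_cons_self a s) with rfl | rfl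
      · exact ⟨m + 1, by rw [Multiset.sum_cons, hm]; push_cast; ring⟩
      · exact ⟨m - 1, by rw [Multiset.sum_cons, hm]; push_cast; ring⟩
  obtain ⟨m, hm⟩ := hsum _ hroot
  refine ⟨m, (algebraMap K L).injective ?_⟩
  have htr : algebraMap K L B.trace = B'.trace := by
    simp [hB', Matrix.trace, map_sum]
  rw [map_pow, htr, Matrix.trace_eq_sum_roots_charpoly, hm, mul_pow, he, map_mul, map_pow,
    map_intCast, mul_comm]

lemma RatFunc.eq_zero_of_sq_add_X_pow_mul_sq {x y : RatFunc ℚ} {k : ℕ}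
    (h : x ^ 2 + RatFunc.X ^ k * y ^ 2 = 0) : x = 0 := by
  have hpoly : ∀ p r : Polynomial ℚ, p ^ 2 + Polynomial.X ^ k * r ^ 2 = 0 → p = 0 := by
    intro p r hpr
    have hlc := congrArg Polynomial.leadingCoeff (eq_neg_of_add_eq_zero_left hpr)
    simp only [Polynomial.leadingCoeff_pow, Polynomial.leadingCoeff_neg,
      Polynomial.leadingCoeff_mul, Polynomial.leadingCoeff_X, one_pow, one_mul] at hlc
    rw [← Polynomial.leadingCoeff_eq_zero]
    nlinarith [sq_nonneg p.leadingCoeff, sq_nonneg r.leadingCoeff]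
  have hx := RatFunc.num_div_denom x
  have hy := RatFunc.num_div_denom y
  have hdx := RatFunc.algebraMap_ne_zero (RatFunc.denom_ne_zero x)
  have hdy := RatFunc.algebraMap_ne_zero (RatFunc.denom_ne_zero y)
  rw [← hx, ← hy, ← RatFunc.algebraMap_X] at h
  field_simp at h
  have h0 := hpoly (x.num * y.denom) (x.denom * y.num) <|
    RatFunc.algebraMap_injective ℚ <| by
      simp only [map_add, map_mul, map_pow, map_zero]
      linear_combination h
  rw [mul_eq_zero, or_iff_left (RatFunc.denom_ne_zero y)] at h0
  exact RatFunc.num_eq_zero_iff.1 h0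

lemma q_ne_zero : q ≠ 0 := RatFunc.X_ne_zero

lemma one_add_q_pow_ne_zero (k : ℕ) : 1 + q ^ k ≠ 0 := by
  intro h
  have h' : (1 + Polynomial.X ^ k : Polynomial ℚ) = 0 := by
    apply RatFunc.algebraMap_injective ℚ
    simpa [q] using h
  have := congrArg (Polynomial.eval 1) h'
  norm_num at this

lemma one_add_q_zpow_ne_zero (k : ℤ) : 1 + q ^ k ≠ 0 := by
  obtain ⟨m, rfl | rfl⟩ := k.eq_nat_or_neg
  · exact_mod_cast one_add_q_pow_ne_zero m
  · intro h
    apply one_add_q_pow_ne_zero m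
    have := pow_ne_zero m q_ne_zero
    rw [zpow_neg, zpow_natCast] at h
    field_simp at h
    linear_combination h

lemma q_pow_succ_ne_one (k : ℕ) : q ^ (k + 1) ≠ 1 := by
  intro h
  have h' : (Polynomial.X ^ (k + 1) : Polynomial ℚ) = 1 := by
    apply RatFunc.algebraMap_injective ℚ
    simpa [q] using h
  simpa using congrArg (Polynomial.eval 0) h'

lemma qPoch_q_ne_zero (k : ℕ) : qPoch q k ≠ 0 := by
  refine prod_ne_zero_iff.2 fun i _ => ?_
  rw [← pow_succ', sub_ne_zero]
  exact (q_pow_succ_ne_one i).symm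

lemma qPoch_succ (a : RatFunc ℚ) (k : ℕ) : qPoch a (k + 1) = qPoch a k * (1 - a * q ^ k) :=
  prod_range_succ _ _

lemma qPochZ_neg_q_add_one (m : ℤ) :
    qPochZ (-q) (m + 1) = qPochZ (-q) m * (1 + q ^ (m + 1)) := by
  obtain ⟨l, rfl | rfl⟩ : ∃ l : ℕ, m = l ∨ m = -(l + 1) := by
    rcases le_or_gt 0 m with h | h
    · exact ⟨m.toNat, Or.inl (by omega)⟩
    · exact ⟨(-m - 1).toNat, Or.inr (by omega)⟩
  · rw [qPochZ, qPochZ, if_pos (by omega), if_pos (by omega),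
      show ((l : ℤ) + 1).toNat = l + 1 by omega, Int.toNat_natCast, qPoch_succ,
      zpow_add_one₀ q_ne_zero, zpow_natCast]
    ring
  · have h : qPochZ (-q) (-(l : ℤ)) = 1 / qPoch (-q * q ^ (-(l : ℤ))) l := by
      rw [qPochZ]
      split_ifs with h0
      · obtain rfl : l = 0 := by omega
        simp [qPoch]
      · simp
    have h' : qPoch (-q * q ^ (-((l : ℤ) + 1))) (l + 1) =
        qPoch (-q * q ^ (-(l : ℤ))) l * (1 + q ^ (-(l : ℤ))) := by
      have hs : q ^ (-(l : ℤ)) = q ^ (-((l : ℤ) + 1)) * q := by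
        rw [← zpow_add_one₀ q_ne_zero]
        congr 1
        ring
      rw [qPoch, prod_range_succ', qPoch, hs]
      congr 1
      · exact prod_congr rfl fun i _ => by ring
      · ring
    rw [show -((l : ℤ) + 1) + 1 = -l by ring, h, qPochZ, if_neg (by omega),
      show (-(-((l : ℤ) + 1))).toNat = l + 1 by omega, h', one_div_mul_eq_div,
      div_mul_cancel_right₀ (one_add_q_zpow_ne_zero _), one_div]

lemma qPochZ_neg_q_eq (n k : ℕ) :
    qPochZ (-q) (k - n - 1) =
      qPochZ (-q) (-n - 1) * (shiftedFactorial q k).eval (-(q ^ n)⁻¹) := by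
  induction k with
  | zero => simp
  | succ k ih =>
    have hk : ((k + 1 : ℕ) : ℤ) - n - 1 = (k - n - 1) + 1 := by push_cast; ring
    rw [hk, qPochZ_neg_q_add_one, ih, eval_shiftedFactorial_succ, sub_add_cancel,
      zpow_sub₀ q_ne_zero, zpow_natCast, zpow_natCast]
    ring

lemma coeff_shiftedFactorial_q (k j : ℕ) :
    (shiftedFactorial q k).coeff j = (-1) ^ j * q ^ (j * (j - 1) / 2) * qbinom k j := by
  rw [qbinom]
  split_ifs with h
  · obtain ⟨i, rfl⟩ : ∃ i, k = i + j := ⟨k - j, by omega⟩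
    rw [show ((i + j : ℕ) : ℤ) - j = i by push_cast; ring]
    simp only [Int.toNat_natCast]
    rw [mul_div_assoc', eq_div_iff (mul_ne_zero (qPoch_q_ne_zero _) (qPoch_q_ne_zero _))]
    clear h
    induction j generalizing i with
    | zero => simp [coeff_zero_shiftedFactorial, qPoch]
    | succ j ih =>
      have h1 := coeff_shiftedFactorial_succ q (i + 1 + j) j
      have h2 := ih (i + 1)
      rw [show i + (j + 1) = i + 1 + j by ring, ← Finset.sum_range_id, Finset.sum_range_succ,
        Finset.sum_range_id, qPoch_succ]
      rw [qPoch_succ] at h2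
      rw [show q ^ (i + 1 + j) - q ^ j = -(q ^ j) * (1 - q * q ^ i) by ring] at h1
      linear_combination (qPoch q j * qPoch q i) * h1 - q ^ j * h2
  · rw [mul_zero]
    exact Polynomial.coeff_eq_zero_of_natDegree_lt
      ((natDegree_shiftedFactorial_le q k).trans_lt (by omega))

lemma reversalMatrix_q_apply (n : ℕ) (s r : Fin (2 * n + 1 + 1)) :
    reversalMatrix q (-(q ^ n)⁻¹) (2 * n + 1) s r =
      (shiftedFactorial q (2 * n + 1 - r)).eval (-(q ^ n)⁻¹) *
        ((-1) ^ (s : ℕ) * q ^ ((s : ℕ) * (s - 1) / 2) *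
          qbinom (2 * (n : ℤ) - (r : ℕ) + 1) (s : ℕ)) := by
  have h : 2 * n + 1 = (2 * n + 1 - r) + r := by omega
  have hT := reversal_X_pow q (-(q ^ n)⁻¹) (2 * n + 1 - r) r
  rw [← h] at hT
  have hc : 2 * (n : ℤ) - (r : ℕ) + 1 = (2 * n + 1 - r : ℕ) := by omega
  rw [reversalMatrix, Matrix.of_apply, hT, Polynomial.coeff_smul, smul_eq_mul,
    coeff_shiftedFactorial_q, hc]

lemma Umul_two_eq_trace (n : ℕ) :
    Umul 2 n = qPochZ (-q) (-n - 1) ^ 2 *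
      (reversalMatrix q (-(q ^ n)⁻¹) (2 * n + 1) *
        reversalMatrix q (-(q ^ n)⁻¹) (2 * n + 1)).trace := by
  have hD (r : Fin (2 * n + 1 + 1)) : qPochZ (-q) ((n : ℤ) - (r : ℕ)) =
      qPochZ (-q) (-n - 1) * (shiftedFactorial q (2 * n + 1 - r)).eval (-(q ^ n)⁻¹) := by
    rw [← qPochZ_neg_q_eq]
    congr 1
    omega
  simp only [Matrix.trace, Matrix.diag, Matrix.mul_apply, mul_sum, reversalMatrix_q_apply]
  rw [← sum_product', Umul]
  symm
  refine sum_bij (fun x _ => ![(x.1 : ℕ), (x.2 : ℕ)]) ?_ ?_ ?_ ?_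
  · intro x _
    simp only [Fintype.mem_piFinset, mem_range, Fin.forall_fin_two, Matrix.cons_val_zero,
      Matrix.cons_val_one]
    omega
  · intro x _ y _ h
    exact Prod.ext (Fin.ext (congrFun h 0)) (Fin.ext (congrFun h 1))
  · intro f hf
    simp only [Fintype.mem_piFinset, mem_range] at hf
    refine ⟨(⟨f 0, hf 0⟩, ⟨f 1, hf 1⟩), by simp, ?_⟩
    ext i
    fin_cases i <;> rfl
  · intro x _
    simp only [Fin.prod_univ_two, Matrix.cons_val_zero, Matrix.cons_val_one, zero_add, hD,
      show (1 + 1 : Fin 2) = 0 from rfl]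
    ring

/-- Theorem 3.1 (first part): `U_2(n) = 0` for `n ≥ 1`. -/
theorem U2_eq_zero (n : ℕ) (hn : 1 ≤ n) : Umul 2 n = 0 := by
  have hw : (-(q ^ n)⁻¹) ^ 2 * q ^ (2 * n + 1) = q := by
    have := pow_ne_zero n q_ne_zero
    rw [pow_succ q, mul_comm 2 n, pow_mul]
    field_simp
  have hw1 : (shiftedFactorial q (2 * n + 1)).eval (-(q ^ n)⁻¹) ≠ 0 := by
    rw [shiftedFactorial, Polynomial.eval_prod]
    refine prod_ne_zero_iff.2 fun i _ => ?_
    have := one_add_q_zpow_ne_zero (i - n)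
    rw [zpow_sub₀ q_ne_zero, zpow_natCast, zpow_natCast] at this
    simpa [div_eq_mul_inv] using this
  obtain ⟨m, hm⟩ := Matrix.exists_trace_sq_eq_of_mul_self_eq
    (reversalMatrix_mul_self_mul_self q_ne_zero q_pow_succ_ne_one hw hw1)
  rw [Umul_two_eq_trace, mul_eq_zero]
  right
  refine RatFunc.eq_zero_of_sq_add_X_pow_mul_sq (k := (2 * n + 1) * (2 * n + 1 - 1) / 2)
    (y := (shiftedFactorial q (2 * n + 1)).eval (-(q ^ n)⁻¹) * m) ?_
  rw [hm, Odd.neg_one_pow ⟨n, rfl⟩, ← q]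
  ring
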